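/- arXiv:2101.02193 — 2 statements merged into one kernel-verified Lean document; each statement's English description precedes it below -/
import Mathlib

section
/- Let β₁ and β₋₁ be the automorphisms of F(a,b) determined by β₁(a) = ab, β₁(b) = b and β₋₁(a) = ab⁻¹, β₋₁(b) = b. Then for every element W of the subgroup ⟨a, b⁻¹ab⟩ of F(a,b), the cyclically reduced lengths satisfy |[β₁(W)]| ≥ |[W]| and |[β₋₁(W)]| ≥ |[W]|. -/
/-- The free group `F(a,b)` on two generators. -/
abbrev F : Type := FreeGroup (Fin 2)

/-- The generator `a` of `F(a,b)`. -/
def a : F := FreeGroup.of 0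

/-- The generator `b` of `F(a,b)`. -/
def b : F := FreeGroup.of 1

/-- The subgroup `⟨a, b⁻¹ab⟩` of `F(a,b)`. -/
def H : Subgroup F := Subgroup.closure {a, b⁻¹ * a * b}

/-- The cyclically reduced length `|[W]|`: the minimal reduced-word length among
all conjugates of `W`. -/
noncomputable def cyclNorm (W : F) : ℕ :=
  sInf {n : ℕ | ∃ g : F, FreeGroup.norm (g * W * g⁻¹) = n}

namespace FreeGroup

theorem mul_cyclNorm_le_norm_pow (W : F) (n : ℕ) : n * cyclNorm W ≤ norm (W ^ n) := by
  have hred : IsReduced W.toWord := isReduced_toWord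
  have hle : cyclNorm W ≤ (reduceCyclically W.toWord).length := by
    refine le_trans (Nat.sInf_le ⟨(mk (reduceCyclically.conjugator W.toWord))⁻¹, rfl⟩) ?_
    have hW : W = mk (reduceCyclically.conjugator W.toWord) * mk (reduceCyclically W.toWord) *
        (mk (reduceCyclically.conjugator W.toWord))⁻¹ := by
      rw [inv_mk, mul_mk, mul_mk, reduceCyclically.conj_conjugator_reduceCyclically, mk_toWord]
    have hconj : (mk (reduceCyclically.conjugator W.toWord))⁻¹ * W *
        (mk (reduceCyclically.conjugator W.toWord))⁻¹⁻¹ = mk (reduceCyclically W.toWord) := by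
      nth_rw 2 [hW]
      group
    rw [hconj]
    exact norm_mk_le
  rcases Nat.eq_zero_or_pos n with rfl | hn
  · simp
  · refine (Nat.mul_le_mul_left n hle).trans ?_
    rw [norm, toWord_pow, reduceCyclically.reduce_flatten_replicate hred, if_neg hn.ne']
    simp
    omega

end FreeGroup

theorem exists_norm_conj_eq_cyclNorm (W : F) :
    ∃ g : F, FreeGroup.norm (g * W * g⁻¹) = cyclNorm W :=
  Nat.sInf_mem (s := {n : ℕ | ∃ g : F, FreeGroup.norm (g * W * g⁻¹) = n}) ⟨_, 1, rfl⟩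

theorem norm_conj_le (g W : F) :
    FreeGroup.norm (g * W * g⁻¹) ≤ FreeGroup.norm W + 2 * FreeGroup.norm g := by
  have h₁ := FreeGroup.norm_mul_le (g * W) g⁻¹
  have h₂ := FreeGroup.norm_mul_le g W
  rw [FreeGroup.norm_inv_eq] at h₁
  omega

theorem norm_le_norm_conj (g W : F) :
    FreeGroup.norm W ≤ FreeGroup.norm (g * W * g⁻¹) + 2 * FreeGroup.norm g := by
  have h := norm_conj_le g⁻¹ (g * W * g⁻¹)
  rw [FreeGroup.norm_inv_eq] at h
  convert h using 3
  group

/-- An endomorphism that shortens the elements of a subgroup `K` by at most a constant does not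
decrease the cyclically reduced length on `K`. -/
theorem cyclNorm_le_of_norm_le_add (β : F →* F) (K : Subgroup F) (C : ℕ)
    (h : ∀ U ∈ K, FreeGroup.norm U ≤ FreeGroup.norm (β U) + C) {W : F} (hW : W ∈ K) :
    cyclNorm W ≤ cyclNorm (β W) := by
  obtain ⟨g, hg⟩ := exists_norm_conj_eq_cyclNorm (β W)
  have norm_pow_le (V : F) (n : ℕ) : FreeGroup.norm (V ^ n) ≤ n * FreeGroup.norm V := by
    induction n with
    | zero => simp
    | succ n ih =>
      rw [pow_succ, Nat.succ_mul]
      exact (FreeGroup.norm_mul_le _ _).trans (by omega)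
  have hbound (n : ℕ) :
      n * cyclNorm W ≤ n * cyclNorm (β W) + (2 * FreeGroup.norm g + C) := by
    have h₁ := FreeGroup.mul_cyclNorm_le_norm_pow W n
    have h₂ := h _ (K.pow_mem hW n)
    have h₃ := norm_le_norm_conj g (β (W ^ n))
    have h₄ := norm_pow_le (g * β W * g⁻¹) n
    rw [hg, conj_pow, ← map_pow] at h₄
    omega
  by_contra! hlt
  have h₁ := hbound (2 * FreeGroup.norm g + C + 1)
  have h₂ := Nat.mul_le_mul_left (2 * FreeGroup.norm g + C + 1) hlt
  rw [Nat.mul_succ] at h₂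
  omega

/-- The embedding of `F(a,b)` onto `⟨bab⁻¹, a⟩ = bHb⁻¹`. -/
noncomputable def conjEmb : F →* F := FreeGroup.lift ![b * a * b⁻¹, a]

theorem exists_conjEmb_of_mem_H {W : F} (hW : W ∈ H) : ∃ X : F, conjEmb X = b * W * b⁻¹ := by
  have hle : H ≤ (conjEmb.range).comap (MulAut.conj b).toMonoidHom := by
    rw [H, Subgroup.closure_le]
    rintro _ (rfl | rfl)
    · exact ⟨FreeGroup.of 0, by simp [conjEmb]⟩
    · exact ⟨FreeGroup.of 1, by simp [conjEmb, mul_assoc]⟩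
  obtain ⟨X, hX⟩ := hle hW
  exact ⟨X, by simpa using hX⟩

theorem norm_conjEmb_mk_le (L : List (Fin 2 × Bool)) :
    FreeGroup.norm (conjEmb (FreeGroup.mk L)) ≤ 2 * L.length + 1 ∧
      FreeGroup.norm (b⁻¹ * conjEmb (FreeGroup.mk L)) ≤ 2 * L.length + 1 := by
  have norm_b : FreeGroup.norm b = 1 := FreeGroup.norm_of 1
  have norm_a : FreeGroup.norm a = 1 := FreeGroup.norm_of 0
  induction L with
  | nil => simp [← FreeGroup.one_eq_mk, FreeGroup.norm_inv_eq, norm_b]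
  | cons x L ih =>
    obtain ⟨ih₁, ih₂⟩ := ih
    obtain ⟨c, hc, hx⟩ : ∃ c : F, FreeGroup.norm c = 1 ∧
        (conjEmb (FreeGroup.mk [x]) = b * c * b⁻¹ ∨ conjEmb (FreeGroup.mk [x]) = c) := by
      obtain ⟨i, s⟩ := x
      refine ⟨cond s a a⁻¹, by cases s <;> simp [FreeGroup.norm_inv_eq, norm_a], ?_⟩
      fin_cases i <;> cases s <;> simp [conjEmb, FreeGroup.lift_mk, mul_assoc]
    have hcons : FreeGroup.mk (x :: L) = FreeGroup.mk [x] * FreeGroup.mk L := by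
      simp [FreeGroup.mul_mk]
    rw [hcons, _root_.map_mul, List.length_cons]
    set Y := conjEmb (FreeGroup.mk L)
    rcases hx with hx | hx <;> rw [hx]
    · have h₁ := FreeGroup.norm_mul_le c (b⁻¹ * Y)
      have h₂ := FreeGroup.norm_mul_le b (c * (b⁻¹ * Y))
      rw [show b⁻¹ * (b * c * b⁻¹ * Y) = c * (b⁻¹ * Y) by group,
        show b * c * b⁻¹ * Y = b * (c * (b⁻¹ * Y)) by group]
      omega
    · have h₁ := FreeGroup.norm_mul_le c Y
      have h₂ := FreeGroup.norm_mul_le b⁻¹ (c * Y)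
      rw [FreeGroup.norm_inv_eq] at h₂
      omega

/-- The first letter of the word substituted for the letter `x`, when the two-letter word
`P i, Q i` is substituted for the `i`-th generator. -/
def fstLetter (P Q : Fin 2 → Fin 2 × Bool) (x : Fin 2 × Bool) : Fin 2 × Bool :=
  cond x.2 (P x.1) ((Q x.1).1, !(Q x.1).2)

/-- The second letter of the word substituted for the letter `x`, when the two-letter word
`P i, Q i` is substituted for the `i`-th generator. -/
def sndLetter (P Q : Fin 2 → Fin 2 × Bool) (x : Fin 2 × Bool) : Fin 2 × Bool :=
  fstLetter Q P x

/-- The substitution of `P i, Q i` for the `i`-th generator takes reduced words to reduced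
words, that is, it never produces cancellation. -/
def NoCancellation (P Q : Fin 2 → Fin 2 × Bool) : Prop :=
  (∀ x, (fstLetter P Q x).1 = (sndLetter P Q x).1 →
    (fstLetter P Q x).2 = (sndLetter P Q x).2) ∧
  ∀ x y : Fin 2 × Bool, (x.1 = y.1 → x.2 = y.2) →
    (sndLetter P Q x).1 = (fstLetter P Q y).1 → (sndLetter P Q x).2 = (fstLetter P Q y).2

instance (P Q : Fin 2 → Fin 2 × Bool) : Decidable (NoCancellation P Q) :=
  inferInstanceAs (Decidable (_ ∧ _))

theorem NoCancellation.isReduced_flatMap {P Q : Fin 2 → Fin 2 × Bool} (h : NoCancellation P Q)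
    {L : List (Fin 2 × Bool)} (hL : FreeGroup.IsReduced L) :
    FreeGroup.IsReduced (L.flatMap fun x => [fstLetter P Q x, sndLetter P Q x]) := by
  induction L with
  | nil => simp
  | cons x L ih =>
    cases L with
    | nil => simpa using h.1 x
    | cons y L =>
      rw [FreeGroup.isReduced_cons_cons] at hL
      have := ih hL.2
      simp only [List.flatMap_cons, List.cons_append, List.nil_append,
        FreeGroup.isReduced_cons_cons] at this ⊢
      exact ⟨h.1 x, h.2 x y hL.1, this⟩

theorem NoCancellation.norm_map {P Q : Fin 2 → Fin 2 × Bool} (h : NoCancellation P Q)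
    (ψ : F →* F) (hψ : ∀ i, ψ (FreeGroup.of i) = FreeGroup.mk [P i, Q i]) (X : F) :
    FreeGroup.norm (ψ X) = 2 * FreeGroup.norm X := by
  have hletter (x : Fin 2 × Bool) :
      ψ (FreeGroup.mk [x]) = FreeGroup.mk [fstLetter P Q x, sndLetter P Q x] := by
    obtain ⟨i, s⟩ := x
    cases s
    · have : (FreeGroup.mk [(i, false)] : F) = (FreeGroup.of i)⁻¹ := by
        simp [FreeGroup.of, FreeGroup.inv_mk, FreeGroup.invRev]
      rw [this, _root_.map_inv, hψ]
      simp [FreeGroup.inv_mk, FreeGroup.invRev, fstLetter, sndLetter]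
    · exact hψ i
  have hword (L : List (Fin 2 × Bool)) : ψ (FreeGroup.mk L) =
      FreeGroup.mk (L.flatMap fun x => [fstLetter P Q x, sndLetter P Q x]) := by
    induction L with
    | nil => simp [← FreeGroup.one_eq_mk]
    | cons x L ih =>
      rw [List.flatMap_cons, ← FreeGroup.mul_mk, ← ih, ← hletter, ← _root_.map_mul,
        FreeGroup.mul_mk, List.singleton_append]
  conv_lhs => rw [← FreeGroup.mk_toWord (x := X), hword]
  rw [FreeGroup.norm, FreeGroup.toWord_mk,
    (h.isReduced_flatMap FreeGroup.isReduced_toWord).reduce_eq, FreeGroup.norm]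
  simp [List.length_flatMap, mul_comm]

/-- If, up to conjugation, `β` takes the basis `bab⁻¹, a` of `bHb⁻¹` to two-letter words whose
substitution produces no cancellation, then `β` does not decrease the cyclically reduced length
of elements of `H`. -/
theorem NoCancellation.cyclNorm_le {P Q : Fin 2 → Fin 2 × Bool} (h : NoCancellation P Q)
    (β : F →* F) (g : F)
    (hβ : ∀ i, g * β (conjEmb (FreeGroup.of i)) * g⁻¹ = FreeGroup.mk [P i, Q i])
    {W : F} (hW : W ∈ H) : cyclNorm W ≤ cyclNorm (β W) := by
  refine cyclNorm_le_of_norm_le_add β H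
    (1 + 2 * FreeGroup.norm b + 2 * FreeGroup.norm (g * β b)) (fun U hU => ?_) hW
  obtain ⟨X, hX⟩ := exists_conjEmb_of_mem_H hU
  have h₁ := h.norm_map ((MulAut.conj g).toMonoidHom.comp (β.comp conjEmb))
    (fun i => by simpa using hβ i) X
  have h₂ := norm_le_norm_conj b U
  have h₃ := (norm_conjEmb_mk_le X.toWord).1
  have h₄ := norm_conj_le (g * β b) (β U)
  have heq : (MulAut.conj g).toMonoidHom.comp (β.comp conjEmb) X =
      g * β b * β U * (g * β b)⁻¹ := by
    simp [hX, mul_assoc]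
  rw [heq] at h₁
  rw [FreeGroup.mk_toWord, hX] at h₃
  change _ ≤ 2 * FreeGroup.norm X + 1 at h₃
  omega

/-- The Whitehead automorphisms `β₁ : a ↦ ab, b ↦ b` and `β₋₁ : a ↦ ab⁻¹, b ↦ b` do not
decrease the cyclically reduced length of elements of `⟨a, b⁻¹ab⟩`. -/
theorem cyclNorm_le_whitehead (β₁ βneg : F ≃* F)
    (h₁a : β₁ a = a * b) (h₁b : β₁ b = b)
    (hna : βneg a = a * b⁻¹) (hnb : βneg b = b)
    (W : F) (hW : W ∈ H) :
    cyclNorm W ≤ cyclNorm (β₁ W) ∧ cyclNorm W ≤ cyclNorm (βneg W) := by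
  have mk_pos (i : Fin 2) (L : List (Fin 2 × Bool)) :
      FreeGroup.mk ((i, true) :: L) = FreeGroup.of i * FreeGroup.mk L := by
    simp [FreeGroup.of, FreeGroup.mul_mk]
  have mk_neg (i : Fin 2) (L : List (Fin 2 × Bool)) :
      FreeGroup.mk ((i, false) :: L) = (FreeGroup.of i)⁻¹ * FreeGroup.mk L := by
    simp [FreeGroup.of, FreeGroup.mul_mk, FreeGroup.inv_mk, FreeGroup.invRev]
  constructor
  · refine NoCancellation.cyclNorm_le (P := ![(1, true), (0, true)])
      (Q := ![(0, true), (1, true)]) (by decide) β₁.toMonoidHom 1 (fun i => ?_) hW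
    fin_cases i <;>
      simp [conjEmb, h₁a, h₁b, mk_pos, ← FreeGroup.one_eq_mk, mul_assoc] <;> rfl
  · refine NoCancellation.cyclNorm_le (P := ![(0, true), (1, false)])
      (Q := ![(1, false), (0, true)]) (by decide) βneg.toMonoidHom b⁻¹ (fun i => ?_) hW
    fin_cases i <;>
      simp [conjEmb, hna, hnb, mk_pos, mk_neg, ← FreeGroup.one_eq_mk, mul_assoc] <;> rfl
end

section
/- For S ∈ F(a,b), the following are equivalent: (i) there exists an automorphism ψ of F(a,b) with ψ(S) ∈ ⟨a, b⁻¹ab⟩; (ii) there exists an element T in the Aut(F(a,b))-orbit of S such that T has shortest length in this orbit (i.e., |T| ≤ |α(S)| for every automorphism α of F(a,b)) and T ∈ ⟨a, b⁻¹ab⟩. -/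
namespace FreeGroup
section Overlap
variable {ι : Type*} [DecidableEq ι]

/-- Length of the longest common prefix of two lists. -/
def lcp {β : Type*} [DecidableEq β] : List β → List β → ℕ
  | x :: l, y :: m => if x = y then lcp l m + 1 else 0
  | [], _ => 0
  | _ :: _, [] => 0

theorem le_lcp_iff {β : Type*} [DecidableEq β] (n : ℕ) (l m : List β) :
    n ≤ lcp l m ↔ n ≤ l.length ∧ n ≤ m.length ∧ l.take n = m.take n := by
  induction l generalizing m n with
  | nil => cases m <;> cases n <;> simp [lcp]
  | cons x l ih =>
    cases m with
    | nil => cases n <;> simp [lcp]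
    | cons y m =>
      cases n with
      | zero => simp
      | succ n =>
        by_cases h : x = y
        · simp [lcp, h, ih]
        · simp [lcp, h]

theorem length_reduce_invRev_append {l m : List (ι × Bool)} (hl : IsReduced l)
    (hm : IsReduced m) :
    (reduce (invRev l ++ m)).length + 2 * lcp l m = l.length + m.length := by
  induction l generalizing m with
  | nil => simp [lcp, hm.reduce_eq]
  | cons x l ih =>
    cases m with
    | nil =>
      have : reduce (invRev (x :: l)) = invRev (x :: l) := by
        rw [reduce_invRev, hl.reduce_eq]
      simp [lcp, this]
    | cons y m =>
      by_cases h : x = y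
      · subst h
        have h1 : reduce (invRev (x :: l) ++ x :: m) = reduce (invRev l ++ m) := by
          rw [← toWord_mk, ← toWord_mk, ← mul_mk, ← mul_mk, ← inv_mk, ← inv_mk,
            ← List.singleton_append (l := l), ← List.singleton_append (l := m),
            ← mul_mk, ← mul_mk]
          group
        have := ih (m := m) (hl.infix ⟨[x], [], by simp⟩) (hm.infix ⟨[x], [], by simp⟩)
        simp only [lcp, if_true, h1, List.length_cons]
        omega
      · have h1 : IsReduced (invRev (x :: l) ++ y :: m) := by
          have h2 : IsReduced (invRev (x :: l)) := by
            rw [isReduced_iff_reduce_eq, reduce_invRev, hl.reduce_eq]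
          rw [IsReduced, List.isChain_append]
          refine ⟨h2, hm, ?_⟩
          intro u hu v hv huv
          simp [invRev] at hu hv
          subst hu hv
          simp at huv ⊢
          by_contra hc
          apply h
          ext
          · exact huv
          · cases hx : x.2 <;> cases hy : y.2 <;> simp_all
        rw [h1.reduce_eq]
        simp [lcp, h]

/-- Length of the longest common prefix of the reduced words of `g` and `h`. -/
def overlap (g h : FreeGroup ι) : ℕ := lcp g.toWord h.toWord

theorem le_overlap_iff (n : ℕ) (g h : FreeGroup ι) : n ≤ overlap g h ↔
    n ≤ norm g ∧ n ≤ norm h ∧ g.toWord.take n = h.toWord.take n :=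
  le_lcp_iff _ _ _

theorem norm_inv_mul_add_overlap (g h : FreeGroup ι) :
    norm (g⁻¹ * h) + 2 * overlap g h = norm g + norm h := by
  have := length_reduce_invRev_append (isReduced_toWord (x := g)) (isReduced_toWord (x := h))
  rwa [← toWord_inv, ← toWord_mul] at this

theorem overlap_comm (g h : FreeGroup ι) : overlap g h = overlap h g :=
  eq_of_forall_le_iff fun n => by
    rw [le_overlap_iff, le_overlap_iff]
    exact ⟨fun ⟨h1, h2, h3⟩ => ⟨h2, h1, h3.symm⟩, fun ⟨h1, h2, h3⟩ => ⟨h2, h1, h3.symm⟩⟩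

theorem le_overlap_trans {n : ℕ} {g h k : FreeGroup ι} (h1 : n ≤ overlap g h)
    (h2 : n ≤ overlap h k) : n ≤ overlap g k := by
  rw [le_overlap_iff] at *
  exact ⟨h1.1, h2.2.1, h1.2.2.trans h2.2.2⟩

theorem overlap_eq_of_lt {g h k : FreeGroup ι} (h1 : overlap h k < overlap g h) :
    overlap g k = overlap h k := by
  apply le_antisymm
  · by_contra hc
    push Not at hc
    have := le_overlap_trans (n := overlap h k + 1) (g := h) (h := g) (k := k)
      (by rw [overlap_comm h g]; omega) (by omega)
    omega
  · exact le_overlap_trans h1.le le_rfl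

theorem norm_lt_norm_mul_self {g : FreeGroup ι} (hg : g ≠ 1) : norm g < norm (g * g) := by
  have h1 := reduceCyclically.conj_conjugator_reduceCyclically g.toWord
  have h2 := reduceCyclically.reduce_flatten_replicate_succ (isReduced_toWord (x := g)) 1
  have h3 : norm (g * g) = (reduce (List.replicate (1 + 1) g.toWord).flatten).length := by
    rw [← toWord_pow, norm, pow_succ, pow_one]
  rw [h2] at h3
  have h4 : reduceCyclically g.toWord ≠ [] := by
    intro h
    rw [h] at h1
    apply hg
    rw [← mk_toWord (x := g), ← h1, List.append_nil, ← mul_mk, ← inv_mk, mul_inv_cancel]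
  have h5 : norm g = _ := congrArg List.length h1.symm
  have := List.length_pos_of_ne_nil h4
  rw [h3, h5]
  simp [List.replicate]
  omega

end Overlap
end FreeGroup

namespace FreeGroup
section Nielsen
variable {ι : Type*} [DecidableEq ι]

/-- The inverse of a letter. -/
def invLetter {κ : Type*} (s : κ × Bool) : κ × Bool := (s.1, !s.2)

theorem le_norm_prod_of_overlap_add_lt {κ : Type*} (V : κ × Bool → FreeGroup ι)
    (hpos : ∀ s t, t ≠ invLetter s → overlap (V s)⁻¹ (V t) < norm (V s))
    (hlt : ∀ r s t, s ≠ invLetter r → t ≠ invLetter s →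
      overlap (V r)⁻¹ (V s) + overlap (V s)⁻¹ (V t) < norm (V s))
    (L : List (κ × Bool)) (hL : IsReduced L) : L.length ≤ norm (L.map V).prod := by
  have key : ∀ (l : List (κ × Bool)) (s : κ × Bool), IsReduced (l ++ [s]) →
      ∀ t, t ≠ invLetter s →
        overlap ((l ++ [s]).map V).prod⁻¹ (V t) = overlap (V s)⁻¹ (V t) ∧
        l.length + 1 + overlap (V s)⁻¹ (V t) ≤ norm ((l ++ [s]).map V).prod := by
    intro l
    induction l using List.reverseRecOn with
    | nil =>
      intro s _ t ht
      have := hpos s t ht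
      simp
      omega
    | append_singleton l s ih =>
      intro t hred u hu
      have hts : t ≠ invLetter s := by
        rintro rfl
        have h2 : IsReduced ([s, invLetter s]) := hred.infix ⟨l, [], by simp⟩
        simp [IsReduced, invLetter] at h2
      obtain ⟨h1, h2⟩ := ih s (hred.infix ⟨[], [t], by simp⟩) t hts
      set g := ((l ++ [s]).map V).prod with hg
      have hg' : ((l ++ [s] ++ [t]).map V).prod = g * V t := by
        rw [List.map_append, List.prod_append, ← hg]; simp
      rw [hg']
      have h3 := norm_inv_mul_add_overlap g⁻¹ (V t)
      have h4 := norm_inv_mul_add_overlap (g * V t)⁻¹ (V t)⁻¹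
      rw [inv_inv] at h3 h4
      simp only [mul_inv_cancel_right, norm_inv_eq] at h3 h4
      have h5 := hlt s t u hts hu
      have h6 : overlap (g * V t)⁻¹ (V u) = overlap (V t)⁻¹ (V u) := by
        apply overlap_eq_of_lt
        omega
      refine ⟨h6, ?_⟩
      simp only [List.length_append, List.length_singleton]
      omega
  induction L using List.reverseRecOn with
  | nil => simp
  | append_singleton l s _ =>
    have := (key l s hL s (by rintro h; simpa [invLetter] using congrArg Prod.snd h)).2
    simp only [List.length_append, List.length_singleton]
    omega

theorem overlap_inv_lt_of_norm_le {g h : FreeGroup ι} (h1 : norm h ≤ norm (g * h)) :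
    2 * overlap g⁻¹ h ≤ norm g := by
  have h3 := norm_inv_mul_add_overlap g⁻¹ h
  rw [inv_inv, norm_inv_eq] at h3
  omega

/-- If two elements cancel exactly half of `v` from either side, then conjugating by the
second half shortens the pair. -/
theorem exists_conj_norm_add_lt {v w : FreeGroup ι} {k : ℕ} (hv : v ≠ 1)
    (hk : norm v = 2 * k) (h1 : k ≤ overlap w v) (h2 : k ≤ overlap v⁻¹ w⁻¹)
    (hw : norm v ≤ norm w) :
    ∃ q, norm (q⁻¹ * v * q) + norm (q⁻¹ * (v⁻¹ * w) * q) < norm v + norm w := by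
  rw [le_overlap_iff] at h1 h2
  obtain ⟨-, -, h1⟩ := h1
  obtain ⟨-, -, h2⟩ := h2
  rw [toWord_inv, toWord_inv] at h2
  set P := v.toWord.take k with hP
  set R := v.toWord.drop k with hR
  have hvl : v.toWord.length = 2 * k := hk
  have hvPR : v.toWord = P ++ R := (List.take_append_drop k _).symm
  have hPl : P.length = k := by simp [hP, hvl]; omega
  have hRl : R.length = k := by simp [hR, hvl]; omega
  have h3 : (invRev v.toWord).take k = invRev R := by
    rw [hvPR, invRev_append, List.take_left' (by simp [hRl])]
  rw [h3] at h2
  have hwl : 2 * k ≤ w.toWord.length := by rw [← hvl]; exact hw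
  obtain ⟨Z, hZ⟩ : ∃ Z, w.toWord = P ++ Z ++ R := by
    have h4 : invRev w.toWord = invRev R ++ (invRev w.toWord).drop k := by
      rw [h2, List.take_append_drop]
    have h5 : w.toWord = invRev ((invRev w.toWord).drop k) ++ R := by
      conv_lhs => rw [← invRev_invRev (L₁ := w.toWord), h4, invRev_append, invRev_invRev]
    set Y := invRev ((invRev w.toWord).drop k) with hY
    have h6 : k ≤ Y.length := by
      have := congrArg List.length h5
      simp only [List.length_append] at this
      omega
    rw [h5, List.take_append_of_le_length h6] at h1
    refine ⟨Y.drop k, ?_⟩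
    rw [h5, ← h1, List.take_append_drop]
  have hv' : v = mk P * mk R := by rw [mul_mk, ← hvPR, mk_toWord]
  have hw' : w = mk P * mk Z * mk R := by rw [mul_mk, mul_mk, ← hZ, mk_toWord]
  refine ⟨(mk R)⁻¹, ?_⟩
  have e1 : (mk R)⁻¹⁻¹ * v * (mk R)⁻¹ = mk R * mk P := by rw [hv']; group
  have e2 : (mk R)⁻¹⁻¹ * (v⁻¹ * w) * (mk R)⁻¹ = mk Z := by rw [hv', hw']; group
  rw [e1, e2]
  have n1 : norm (mk R * mk P) ≤ k + k := by
    refine (norm_mul_le _ _).trans (Nat.add_le_add ?_ ?_)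
    · exact norm_mk_le.trans hRl.le
    · exact norm_mk_le.trans hPl.le
  have n2 : norm (mk Z) ≤ Z.length := norm_mk_le
  have n3 : norm w = k + Z.length + k := by
    rw [norm, hZ]; simp only [List.length_append, hPl, hRl]
  have n4 : 0 < norm v := Nat.pos_of_ne_zero (by simpa using hv)
  omega

theorem le_norm_prod_of_minimal (V : Fin 2 × Bool → FreeGroup ι)
    (hV : ∀ s, V (invLetter s) = (V s)⁻¹) (hne : ∀ s, V s ≠ 1)
    (hmin : ∀ s t, s.1 ≠ t.1 → ∀ q,
      norm (V s) + norm (V t) ≤ norm (q⁻¹ * V s * q) + norm (q⁻¹ * ((V s)⁻¹ * V t) * q))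
    (L : List (Fin 2 × Bool)) (hL : IsReduced L) : L.length ≤ norm (L.map V).prod := by
  have hinv : ∀ s : Fin 2 × Bool, invLetter (invLetter s) = s := by simp [invLetter]
  have eq_or : ∀ s t : Fin 2 × Bool, s.1 = t.1 → s = t ∨ s = invLetter t := by
    rintro ⟨i, e⟩ ⟨j, f⟩ (rfl : i = j)
    cases e <;> cases f <;> simp [invLetter]
  have hpos : ∀ s, 0 < norm (V s) := fun s => Nat.pos_of_ne_zero (by simpa using hne s)
  have mul_le : ∀ s t, s.1 ≠ t.1 → norm (V t) ≤ norm (V s * V t) := by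
    intro s t h
    have := hmin (invLetter s) t h 1
    simp [hV] at this
    omega
  have same : ∀ s, 2 * overlap (V s)⁻¹ (V s) < norm (V s) := by
    intro s
    have h1 := norm_inv_mul_add_overlap (V s)⁻¹ (V s)
    have h2 := norm_lt_norm_mul_self (hne s)
    rw [inv_inv, norm_inv_eq] at h1
    omega
  have left : ∀ s t, t ≠ invLetter s → 2 * overlap (V s)⁻¹ (V t) ≤ norm (V s) := by
    intro s t h
    by_cases hst : t.1 = s.1
    · obtain rfl : t = s := (eq_or t s hst).resolve_right h
      exact (same t).le
    · exact overlap_inv_lt_of_norm_le (mul_le s t (Ne.symm hst))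
  have right : ∀ s t, t ≠ invLetter s → 2 * overlap (V s)⁻¹ (V t) ≤ norm (V t) := by
    intro s t h
    have := left (invLetter t) (invLetter s) (by
      rw [hinv]; rintro rfl; exact h rfl)
    rwa [hV, hV, inv_inv, overlap_comm, norm_inv_eq] at this
  refine le_norm_prod_of_overlap_add_lt V (fun s t h => ?_) (fun r s t h1 h2 => ?_) L hL
  · have := left s t h
    have := hpos s
    omega
  · have hr := right r s h1
    have hs := left s t h2
    by_contra hc
    have hc1 : 2 * overlap (V r)⁻¹ (V s) = norm (V s) := by omega
    have hc2 : 2 * overlap (V s)⁻¹ (V t) = norm (V s) := by omega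
    have hrs : s.1 ≠ r.1 := by
      intro h
      obtain rfl := (eq_or s r h).resolve_right h1
      have := same s
      omega
    have hst : t.1 ≠ s.1 := by
      intro h
      obtain rfl := (eq_or t s h).resolve_right h2
      have := same t
      omega
    have hrt : t.1 = r.1 := by omega
    rcases eq_or t r hrt with rfl | rfl
    · have hle := left t s h1
      obtain ⟨q, hq⟩ := exists_conj_norm_add_lt (v := V s) (w := (V t)⁻¹)
        (k := overlap (V t)⁻¹ (V s)) (hne s) hc1.symm le_rfl (by rw [inv_inv]; omega)
        (by rw [norm_inv_eq]; omega)
      have := hmin s (invLetter t) hst.symm q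
      rw [hV] at this
      omega
    · rw [hV] at hc2
      have h3 : overlap (V r)⁻¹ (V s) ≤ overlap (V s)⁻¹ (V s) :=
        le_overlap_trans (h := (V r)⁻¹) (by omega) le_rfl
      have := same s
      omega

end Nielsen
end FreeGroup

open FreeGroup hiding map_mul map_inv map_one norm_one

/-- The endomorphism of `F(a,b)` sending `a` to `x` and `b` to `y`. -/
def homOf (x y : F) : F →* F := FreeGroup.lift ![x, y]

@[simp] theorem homOf_a (x y : F) : homOf x y a = x := by simp [homOf, a]

@[simp] theorem homOf_b (x y : F) : homOf x y b = y := by simp [homOf, b]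

theorem hom_ext_ab {G : Type*} [Group G] {f g : F →* G} (ha : f a = g a) (hb : f b = g b) :
    f = g := by
  ext i
  fin_cases i
  · exact ha
  · exact hb

theorem aut_ext_ab {f g : MulAut F} (ha : f a = g a) (hb : f b = g b) : f = g :=
  MulEquiv.toMonoidHom_injective (hom_ext_ab ha hb)

/-- The automorphism given by mutually inverse substitutions. -/
def autOf (x y x' y' : F) (h₁ : homOf x' y' x = a) (h₂ : homOf x' y' y = b)
    (h₃ : homOf x y x' = a) (h₄ : homOf x y y' = b) : MulAut F :=
  MonoidHom.toMulEquiv (homOf x y) (homOf x' y')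
    (hom_ext_ab (by simpa using h₁) (by simpa using h₂))
    (hom_ext_ab (by simpa using h₃) (by simpa using h₄))

/-- The transvection `a ↦ a`, `b ↦ ab`. -/
def transL : MulAut F := autOf a (a * b) a (a⁻¹ * b) (by simp) (by simp) (by simp) (by simp)

/-- The transvection `a ↦ ba`, `b ↦ b`. -/
def transR : MulAut F := autOf (b * a) b (b⁻¹ * a) b (by simp) (by simp) (by simp) (by simp)

/-- The automorphism exchanging `a` and `b`. -/
def swapAB : MulAut F := autOf b a b a (by simp) (by simp) (by simp) (by simp)

/-- The automorphism `a ↦ a⁻¹`, `b ↦ b`. -/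
def invA : MulAut F := autOf a⁻¹ b a⁻¹ b (by simp) (by simp) (by simp) (by simp)

/-- The automorphism `a ↦ a`, `b ↦ b⁻¹`. -/
def invB : MulAut F := autOf a b⁻¹ a b⁻¹ (by simp) (by simp) (by simp) (by simp)

@[simp] theorem transL_a : transL a = a := homOf_a a (a * b)
@[simp] theorem transL_b : transL b = a * b := homOf_b a (a * b)
@[simp] theorem transL_symm_a : transL.symm a = a := homOf_a a (a⁻¹ * b)
@[simp] theorem transL_symm_b : transL.symm b = a⁻¹ * b := homOf_b a (a⁻¹ * b)
@[simp] theorem transR_a : transR a = b * a := homOf_a (b * a) b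
@[simp] theorem transR_b : transR b = b := homOf_b (b * a) b
@[simp] theorem transR_symm_a : transR.symm a = b⁻¹ * a := homOf_a (b⁻¹ * a) b
@[simp] theorem transR_symm_b : transR.symm b = b := homOf_b (b⁻¹ * a) b
@[simp] theorem swapAB_a : swapAB a = b := homOf_a b a
@[simp] theorem swapAB_b : swapAB b = a := homOf_b b a
@[simp] theorem invA_a : invA a = a⁻¹ := homOf_a a⁻¹ b
@[simp] theorem invA_b : invA b = b := homOf_b a⁻¹ b
@[simp] theorem invB_a : invB a = a := homOf_a a b⁻¹
@[simp] theorem invB_b : invB b = b⁻¹ := homOf_b a b⁻¹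

theorem norm_a : norm a = 1 := norm_of _

theorem norm_b : norm b = 1 := norm_of _

theorem mk_eq_prod_letters (L : List (Fin 2 × Bool)) :
    (mk L : F) = (L.map fun s => mk [s]).prod := by
  induction L with
  | nil => rfl
  | cons s L ih => rw [List.map_cons, List.prod_cons, ← ih, mul_mk, List.singleton_append]

theorem mk_invLetter (s : Fin 2 × Bool) : (mk [invLetter s] : F) = (mk [s])⁻¹ := by
  simp [invLetter, inv_mk, invRev]

theorem mk_letter (s : Fin 2 × Bool) :
    (s.1 = 0 ∧ ((mk [s] : F) = a ∨ (mk [s] : F) = a⁻¹)) ∨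
      (s.1 = 1 ∧ ((mk [s] : F) = b ∨ (mk [s] : F) = b⁻¹)) := by
  obtain ⟨i, e⟩ := s
  fin_cases i <;> cases e
  · exact .inl ⟨rfl, .inr rfl⟩
  · exact .inl ⟨rfl, .inl rfl⟩
  · exact .inr ⟨rfl, .inr rfl⟩
  · exact .inr ⟨rfl, .inl rfl⟩

theorem mk_letter_ne_one (s : Fin 2 × Bool) : (mk [s] : F) ≠ 1 := by
  rcases mk_letter s with ⟨-, h | h⟩ | ⟨-, h | h⟩ <;> rw [h] <;> simp [a, b]

theorem exists_mk_letter_of_norm_le_one {g : F} (hg : g ≠ 1) (h : norm g ≤ 1) :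
    ∃ s, g = mk [s] := by
  have h1 : norm g = 1 := le_antisymm h (Nat.pos_of_ne_zero (by simpa using hg))
  obtain ⟨s, hs⟩ := List.length_eq_one_iff.mp h1
  exact ⟨s, by rw [← hs, mk_toWord]⟩

/-- The automorphisms of `F(a,b)` preserving word length. -/
def normPreserving : Subgroup (MulAut F) where
  carrier := {σ | ∀ g, norm (σ g) = norm g}
  mul_mem' hσ hτ g := by rw [MulAut.mul_apply, hσ, hτ]
  one_mem' _ := rfl
  inv_mem' {σ} hσ g := by rw [← hσ, MulAut.apply_inv_self]

theorem norm_apply_le {f : MulAut F} (ha : norm (f a) ≤ 1) (hb : norm (f b) ≤ 1) (g : F) :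
    norm (f g) ≤ norm g := by
  have key : ∀ L : List (Fin 2 × Bool), norm (f (mk L)) ≤ L.length := by
    intro L
    induction L with
    | nil =>
      have : (mk [] : F) = 1 := rfl
      simp [this]
    | cons s L ih =>
      rw [← List.singleton_append, ← mul_mk, map_mul, List.length_append, add_comm]
      refine (FreeGroup.norm_mul_le _ _).trans (by
        rw [add_comm]
        refine Nat.add_le_add ih ?_
        rcases mk_letter s with ⟨-, h | h⟩ | ⟨-, h | h⟩ <;> rw [h] <;> simpa)
  have := key g.toWord
  rwa [mk_toWord] at this

theorem mem_normPreserving_of_involutive {f : MulAut F} (ha : norm (f a) ≤ 1)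
    (hb : norm (f b) ≤ 1) (hf : f * f = 1) : f ∈ normPreserving := fun g =>
  le_antisymm (norm_apply_le ha hb g) (by
    have := norm_apply_le ha hb (f g)
    rwa [← MulAut.mul_apply, hf] at this)

theorem swapAB_mem : swapAB ∈ normPreserving :=
  mem_normPreserving_of_involutive (by simp [norm_b]) (by simp [norm_a])
    (aut_ext_ab (by simp) (by simp))

theorem invA_mem : invA ∈ normPreserving :=
  mem_normPreserving_of_involutive (by simp [norm_a]) (by simp [norm_b])
    (aut_ext_ab (by simp) (by simp))

theorem invB_mem : invB ∈ normPreserving :=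
  mem_normPreserving_of_involutive (by simp [norm_a]) (by simp [norm_b])
    (aut_ext_ab (by simp) (by simp))

theorem exists_normPreserving (s t : Fin 2 × Bool) (hst : s.1 ≠ t.1) :
    ∃ σ ∈ normPreserving, σ a = mk [s] ∧ σ b = mk [t] := by
  have h1 := swapAB_mem
  have h2 := invA_mem
  have h3 := invB_mem
  rcases mk_letter s with ⟨hs, h | h⟩ | ⟨hs, h | h⟩ <;>
    rcases mk_letter t with ⟨ht, h' | h'⟩ | ⟨ht, h' | h'⟩ <;>
    (try (exact absurd (hs.trans ht.symm) hst)) <;> rw [h, h']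
  · exact ⟨1, one_mem _, rfl, rfl⟩
  · exact ⟨invB, h3, by simp, by simp⟩
  · exact ⟨invA, h2, by simp, by simp⟩
  · exact ⟨invA * invB, mul_mem h2 h3, by simp, by simp⟩
  · exact ⟨swapAB, h1, by simp, by simp⟩
  · exact ⟨invA * swapAB, mul_mem h2 h1, by simp, by simp⟩
  · exact ⟨invB * swapAB, mul_mem h3 h1, by simp, by simp⟩
  · exact ⟨invB * invA * swapAB, mul_mem (mul_mem h3 h2) h1, by simp, by simp⟩

theorem b_ne_a : b ≠ a := fun h => by simpa using FreeGroup.of_injective h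

theorem b_ne_a_inv : b ≠ a⁻¹ := fun h => by
  have := congrArg toWord h
  simp [a, b, invRev] at this

theorem letters_of_norm_le_one {σ : MulAut F} (ha : norm (σ a) ≤ 1) (hb : norm (σ b) ≤ 1) :
    ∃ s t, s.1 ≠ t.1 ∧ σ a = mk [s] ∧ σ b = mk [t] := by
  obtain ⟨s, hs⟩ := exists_mk_letter_of_norm_le_one (by simp [a]) ha
  obtain ⟨t, ht⟩ := exists_mk_letter_of_norm_le_one (by simp [b]) hb
  refine ⟨s, t, fun h => ?_, hs, ht⟩
  have : t = s ∨ t = invLetter s := by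
    obtain ⟨i, e⟩ := s
    obtain ⟨j, f⟩ := t
    obtain rfl : i = j := h
    cases e <;> cases f <;> simp [invLetter]
  rcases this with rfl | rfl
  · exact b_ne_a (σ.injective (ht.trans hs.symm))
  · rw [mk_invLetter, ← hs, ← map_inv] at ht
    exact b_ne_a_inv (σ.injective ht)

/-- **Nielsen's theorem** in rank two: the automorphism group is generated by the length
preserving automorphisms, the inner automorphisms and one transvection. -/
theorem mem_of_nielsen_generators (K : Subgroup (MulAut F)) (hs : normPreserving ≤ K)
    (hc : ∀ c, MulAut.conj c ∈ K) (hL : transL ∈ K) (α : MulAut F) : α ∈ K := by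
  let len : K → ℕ := fun β => norm (α (β.1 a)) + norm (α (β.1 b))
  set β : K := Function.argmin len with hβ
  have hmin : ∀ β' : K, len β ≤ len β' := fun β' => Function.argmin_le len β'
  set γ : MulAut F := α * β.1 with hγ
  let V : Fin 2 × Bool → F := fun s => γ (mk [s])
  have hV : ∀ s, V (invLetter s) = (V s)⁻¹ := fun s => by simp only [V, mk_invLetter, map_inv]
  have hnorm : ∀ s t, s.1 ≠ t.1 → norm (V s) + norm (V t) = len β := by
    intro s t hst
    have ha : norm (γ a⁻¹) = norm (γ a) := by rw [map_inv, norm_inv_eq]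
    have hb : norm (γ b⁻¹) = norm (γ b) := by rw [map_inv, norm_inv_eq]
    have hlen : len β = norm (γ a) + norm (γ b) := rfl
    rcases mk_letter s with ⟨hs, h | h⟩ | ⟨hs, h | h⟩ <;>
      rcases mk_letter t with ⟨ht, h' | h'⟩ | ⟨ht, h' | h'⟩ <;>
      first
      | exact absurd (hs.trans ht.symm) hst
      | (simp only [V, h, h']; omega)
  have hlen : ∀ L, IsReduced L → L.length ≤ norm (γ (mk L)) := by
    intro L hL'
    have := le_norm_prod_of_minimal V hV
      (fun s h => mk_letter_ne_one s (by simpa [V] using h)) (fun s t hst q => by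
        obtain ⟨σ, hσ, hσa, hσb⟩ := exists_normPreserving s t hst
        obtain ⟨r, hr⟩ := γ.surjective q⁻¹
        rw [hnorm s t hst]
        refine (hmin (β * ⟨MulAut.conj r * σ * transL⁻¹,
          mul_mem (mul_mem (hc _) (hs hσ)) (inv_mem hL)⟩)).trans (le_of_eq ?_)
        have e : ∀ g, α ((β * ⟨MulAut.conj r * σ * transL⁻¹,
            mul_mem (mul_mem (hc _) (hs hσ)) (inv_mem hL)⟩ : K).1 g) =
            q⁻¹ * γ (σ (transL⁻¹ g)) * q := by
          intro g
          change γ (MulAut.conj r (σ (transL⁻¹ g))) = _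
          simp only [MulAut.conj_apply, map_mul, map_inv, hr, inv_inv]
        have ha : transL⁻¹ a = a := transL_symm_a
        have hb : transL⁻¹ b = a⁻¹ * b := transL_symm_b
        simp only [len, e, ha, hb, map_mul, map_inv, hσa, hσb, V]) L hL'
    rwa [show (L.map V).prod = γ (mk L) by
      rw [mk_eq_prod_letters, map_list_prod, List.map_map]; rfl] at this
  have hle : ∀ g, norm (γ⁻¹ g) ≤ norm g := by
    intro g
    have := hlen (γ⁻¹ g).toWord isReduced_toWord
    rwa [mk_toWord, MulAut.apply_inv_self] at this
  obtain ⟨s, t, hst, hsa, htb⟩ := letters_of_norm_le_one (σ := γ⁻¹)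
    ((hle a).trans norm_a.le) ((hle b).trans norm_b.le)
  obtain ⟨σ, hσ, hσa, hσb⟩ := exists_normPreserving s t hst
  have hγσ : γ⁻¹ = σ := aut_ext_ab (hsa.trans hσa.symm) (htb.trans hσb.symm)
  have hγK : γ ∈ K := by
    rw [← inv_mem_iff, hγσ]
    exact hs hσ
  exact (Subgroup.mul_mem_cancel_right K β.2).mp hγK

/-- The element `∏ aᵖ b⁻¹ a^q b` over the pairs `(p, q)` of a list. -/
def blocks (l : List (ℤ × ℤ)) : F := (l.map fun p => a ^ p.1 * b⁻¹ * a ^ p.2 * b).prod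

/-- The word length of `blocks l` when all exponents are nonzero. -/
def blocksLength (l : List (ℤ × ℤ)) : ℕ := (l.map fun p => p.1.natAbs + p.2.natAbs + 2).sum

/-- The positive automorphism given by a word in the two transvections. -/
def positiveAut (w : List Bool) : MulAut F := (w.map fun e => cond e transL transR).prod

theorem positiveAut_cons (e : Bool) (w : List Bool) (g : F) :
    positiveAut (e :: w) g = (cond e transL transR) (positiveAut w g) := by
  simp [positiveAut]

theorem positiveAut_concat (w : List Bool) (e : Bool) (g : F) :
    positiveAut (w ++ [e]) g = positiveAut w ((cond e transL transR) g) := by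
  simp [positiveAut]

theorem map_blocks (f : MulAut F) (l : List (ℤ × ℤ)) :
    f (blocks l) = (l.map fun p => f a ^ p.1 * (f b)⁻¹ * f a ^ p.2 * f b).prod := by
  simp [blocks, map_list_prod, Function.comp_def]

theorem transL_blocks (l : List (ℤ × ℤ)) : transL (blocks l) = blocks l := by
  rw [map_blocks, blocks]
  congr 2
  ext p
  simp only [transL_a, transL_b]
  have : (a * b)⁻¹ * a ^ p.2 * (a * b) = b⁻¹ * a ^ p.2 * b := by group
  simp only [mul_assoc] at this ⊢
  rw [this]

theorem transR_blocks (l : List (ℤ × ℤ)) :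
    transR (blocks l) = (l.map fun p => (b * a) ^ p.1 * (a * b) ^ p.2).prod := by
  rw [map_blocks]
  congr 2
  ext p
  have : b⁻¹ * (b * a) ^ p.2 * b = (a * b) ^ p.2 := by
    have := conj_zpow (i := p.2) (a := b⁻¹) (b := b * a)
    rw [inv_inv] at this
    rw [← this]
    simp
  simp only [transR_a, transR_b, ← this, mul_assoc]

theorem invA_blocks (l : List (ℤ × ℤ)) :
    invA (blocks l) = blocks (l.map fun p => (-p.1, -p.2)) := by
  rw [map_blocks, blocks, List.map_map]
  simp [Function.comp_def]

theorem transL_normPreserving {σ : MulAut F} (hσ : σ ∈ normPreserving) :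
    ∃ c, ∃ τ ∈ [transL, transR, transL⁻¹, transR⁻¹], ∀ g, transL (σ g) = c * σ (τ g) * c⁻¹ := by
  have key : ∀ c, ∀ τ ∈ [transL, transR, transL⁻¹, transR⁻¹],
      transL (σ a) = c * σ (τ a) * c⁻¹ → transL (σ b) = c * σ (τ b) * c⁻¹ →
      ∃ c, ∃ τ ∈ [transL, transR, transL⁻¹, transR⁻¹], ∀ g, transL (σ g) = c * σ (τ g) * c⁻¹ := by
    intro c τ hτ ha hb
    refine ⟨c, τ, hτ, fun g => ?_⟩
    have : transL * σ = MulAut.conj c * σ * τ := aut_ext_ab (by simpa using ha) (by simpa using hb)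
    simpa using DFunLike.congr_fun this g
  obtain ⟨s, t, hst, hs, ht⟩ := letters_of_norm_le_one (σ := σ) ((hσ a).trans_le norm_a.le)
    ((hσ b).trans_le norm_b.le)
  rcases mk_letter s with ⟨h1, h | h⟩ | ⟨h1, h | h⟩ <;>
    rcases mk_letter t with ⟨h2, h' | h'⟩ | ⟨h2, h' | h'⟩ <;>
    (try (exact absurd (h1.trans h2.symm) hst)) <;> rw [h] at hs <;> rw [h'] at ht
  · exact key 1 transL (by simp) (by simp [hs]) (by simp [hs, ht])
  · exact key a transL⁻¹ (by simp) (by simp [hs]) (by simp [hs, ht])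
  · exact key 1 transL⁻¹ (by simp) (by simp [hs]) (by simp [hs, ht])
  · exact key a transL (by simp) (by simp [hs]) (by simp [hs, ht])
  · exact key 1 transR (by simp) (by simp [hs, ht]) (by simp [ht])
  · exact key 1 transR⁻¹ (by simp) (by simp [hs, ht]) (by simp [ht])
  · exact key a transR⁻¹ (by simp) (by simp [hs, ht]) (by simp [ht])
  · exact key a transR (by simp) (by simp [hs, ht]) (by simp [ht])

/-- Elements conjugate to `σ (φ (blocks l))` with `σ` length preserving, `φ` positive, and all
exponents in `l` nonzero; `n` is the length of `blocks l`. -/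
def IsPositiveImage (n : ℕ) (g : F) : Prop :=
  ∃ c, ∃ σ ∈ normPreserving, ∃ w l, (∀ p ∈ l, p.1 ≠ 0 ∧ p.2 ≠ 0) ∧ blocksLength l = n ∧
    g = c * σ (positiveAut w (blocks l)) * c⁻¹

namespace IsPositiveImage

theorem conj {n : ℕ} {g : F} (h : IsPositiveImage n g) (d : F) :
    IsPositiveImage n (d * g * d⁻¹) := by
  obtain ⟨c, σ, hσ, w, l, hl, hn, rfl⟩ := h
  exact ⟨d * c, σ, hσ, w, l, hl, hn, by group⟩

theorem map_normPreserving {n : ℕ} {g : F} (h : IsPositiveImage n g) {τ : MulAut F}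
    (hτ : τ ∈ normPreserving) : IsPositiveImage n (τ g) := by
  obtain ⟨c, σ, hσ, w, l, hl, hn, rfl⟩ := h
  exact ⟨τ c, τ * σ, mul_mem hτ hσ, w, l, hl, hn, by simp⟩

theorem transvection_positiveAut {l : List (ℤ × ℤ)} (hl : ∀ p ∈ l, p.1 ≠ 0 ∧ p.2 ≠ 0)
    (w : List Bool) {τ : MulAut F} (hτ : τ ∈ [transL, transR, transL⁻¹, transR⁻¹]) :
    IsPositiveImage (blocksLength l) (τ (positiveAut w (blocks l))) := by
  have self : ∀ w, IsPositiveImage (blocksLength l) (positiveAut w (blocks l)) := fun w =>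
    ⟨1, 1, one_mem _, w, l, hl, rfl, by simp⟩
  have key : ∀ c, ∀ σ ∈ normPreserving, ∀ τ₁ τ₂ τ₃ : MulAut F,
      τ₁ (τ₂ a) = c * σ (τ₃ a) * c⁻¹ → τ₁ (τ₂ b) = c * σ (τ₃ b) * c⁻¹ →
      ∀ g, IsPositiveImage (blocksLength l) (τ₃ g) →
      IsPositiveImage (blocksLength l) (τ₁ (τ₂ g)) := by
    intro c σ hσ τ₁ τ₂ τ₃ ha hb g hg
    have : τ₁ * τ₂ = MulAut.conj c * σ * τ₃ := aut_ext_ab (by simpa using ha) (by simpa using hb)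
    have h := DFunLike.congr_fun this g
    simp only [MulAut.mul_apply, MulAut.conj_apply] at h
    rw [h]
    exact (hg.map_normPreserving hσ).conj c
  simp only [List.mem_cons, List.not_mem_nil, or_false] at hτ
  rcases hτ with rfl | rfl | rfl | rfl
  · exact positiveAut_cons true w (blocks l) ▸ self (true :: w)
  · exact positiveAut_cons false w (blocks l) ▸ self (false :: w)
  · match w with
    | [] =>
      have h : transL⁻¹ (positiveAut [] (blocks l)) = positiveAut [] (blocks l) := by
        change transL⁻¹ (blocks l) = blocks l
        conv_lhs => rw [← transL_blocks, MulAut.inv_apply_self]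
      rw [h]
      exact self []
    | true :: w =>
      rw [positiveAut_cons, cond_true, MulAut.inv_apply_self]
      exact self w
    | false :: w =>
      rw [positiveAut_cons]
      refine key a⁻¹ (invA * swapAB) (mul_mem invA_mem swapAB_mem) _ transR transL ?_ ?_ _
        (positiveAut_cons true w (blocks l) ▸ self (true :: w))
      · simp
      · simp [mul_assoc]
  · match w with
    | [] =>
      have h := key b⁻¹ invA invA_mem transR⁻¹ 1 (transR * invA) (by simp [mul_assoc])
        (by simp) (blocks l)
      refine h ?_
      rw [MulAut.mul_apply, invA_blocks]
      refine ⟨1, 1, one_mem _, [false], l.map fun p => (-p.1, -p.2), ?_, ?_, ?_⟩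
      · simp only [List.mem_map]
        rintro _ ⟨p, hp, rfl⟩
        simpa using hl p hp
      · simp [blocksLength, Function.comp_def]
      · rw [one_mul, inv_one, mul_one]
        rfl
    | false :: w =>
      rw [positiveAut_cons, cond_false, MulAut.inv_apply_self]
      exact self w
    | true :: w =>
      rw [positiveAut_cons]
      refine key b⁻¹ (invB * swapAB) (mul_mem invB_mem swapAB_mem) _ transL transR ?_ ?_ _
        (positiveAut_cons false w (blocks l) ▸ self (false :: w))
      · simp [mul_assoc]
      · simp

theorem map_transL {n : ℕ} {g : F} (h : IsPositiveImage n g) :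
    IsPositiveImage n (transL g) := by
  obtain ⟨c, σ, hσ, w, l, hl, rfl, rfl⟩ := h
  obtain ⟨d, τ, hτ, h⟩ := transL_normPreserving hσ
  rw [map_mul, map_mul, map_inv, h]
  exact (((transvection_positiveAut hl w hτ).map_normPreserving hσ).conj d).conj _

theorem map {n : ℕ} {g : F} (h : IsPositiveImage n g) (α : MulAut F) :
    IsPositiveImage n (α g) := by
  let K : Subgroup (MulAut F) :=
    { carrier := {α | ∀ g, IsPositiveImage n (α g) ↔ IsPositiveImage n g}
      mul_mem' := fun {α β} hα hβ g => by rw [MulAut.mul_apply, hα, hβ]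
      one_mem' := fun _ => Iff.rfl
      inv_mem' := fun {α} hα g => by rw [← hα, MulAut.apply_inv_self] }
  have hK : ∀ α, α ∈ K := by
    refine mem_of_nielsen_generators K (fun σ hσ g => ⟨fun h => ?_, fun h => ?_⟩)
      (fun c g => ⟨fun h => ?_, fun h => h.conj c⟩) (fun g => ⟨fun h => ?_, map_transL⟩)
    · have := h.map_normPreserving (inv_mem hσ)
      rwa [MulAut.inv_apply_self] at this
    · exact h.map_normPreserving hσ
    · have := h.conj c⁻¹
      rw [MulAut.conj_apply] at this
      convert this using 1
      group
    · have h1 := (h.map_normPreserving invA_mem).map_transL.map_normPreserving invA_mem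
      have h2 : invA * transL * invA * transL = 1 := aut_ext_ab (by simp) (by simp)
      have h3 : invA (transL (invA (transL g))) = g := DFunLike.congr_fun h2 g
      rwa [h3] at h1
  exact (hK α g).mpr h

end IsPositiveImage

theorem isReduced_of_forall_snd_eq {L : List (Fin 2 × Bool)} {e : Bool} (h : ∀ x ∈ L, x.2 = e) :
    IsReduced L :=
  List.Pairwise.isChain
    (List.pairwise_of_forall_mem_list fun x hx y hy (_ : x.1 = y.1) => (h x hx).trans (h y hy).symm)

/-- The letters of `ba` (for `true`) or of `ab` (for `false`). -/
def tailLetters (s : Bool) : List (Fin 2 × Bool) :=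
  cond s [(1, true), (0, true)] [(0, true), (1, true)]

theorem tailLetters_ne_nil (s : Bool) : tailLetters s ≠ [] := by cases s <;> simp [tailLetters]

theorem length_tailLetters (s : Bool) : (tailLetters s).length = 2 := by cases s <;> rfl

theorem snd_of_mem_tailLetters {s : Bool} : ∀ x ∈ tailLetters s, x.2 = true := by
  cases s <;> simp [tailLetters]

theorem snd_of_mem_invRev {L : List (Fin 2 × Bool)} (h : ∀ x ∈ L, x.2 = true) :
    ∀ x ∈ invRev L, x.2 = false := by
  intro x hx
  simp only [invRev, List.mem_reverse, List.mem_map] at hx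
  obtain ⟨y, hy, rfl⟩ := hx
  simp [h y hy]

/-- The reduced word of `g` ends with `tailLetters s` (if `e`) or with the inverse of
`P ++ tailLetters s` (otherwise), and `n` bounds its length, less `P.length` if `¬ e`. -/
def EndsIn (P : List (Fin 2 × Bool)) (s : Bool) : Bool → F → ℤ → Prop
  | true, g, n => ∃ V, IsReduced (V ++ tailLetters s) ∧ g = mk (V ++ tailLetters s) ∧
      n ≤ V.length + 2
  | false, g, n => ∃ V, IsReduced (V ++ invRev (tailLetters s) ++ invRev P) ∧
      g = mk (V ++ invRev (tailLetters s) ++ invRev P) ∧ n + P.length ≤ V.length + 2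

namespace EndsIn

variable {P : List (Fin 2 × Bool)} {s s' : Bool} {g : F} {n : ℤ}

theorem le_norm {e : Bool} (h : EndsIn P s e g n) : n ≤ norm g := by
  cases e <;> obtain ⟨V, hV, rfl, hn⟩ := h <;>
    rw [FreeGroup.norm, toWord_mk, hV.reduce_eq] <;> simp [length_tailLetters] <;> omega

theorem pos_pos (hP : ∀ x ∈ P, x.2 = true) (h : EndsIn P s true g n) :
    EndsIn P s' true (g * mk (P ++ tailLetters s')) (n + P.length + 2) := by
  obtain ⟨V, hV, rfl, hn⟩ := h
  refine ⟨V ++ tailLetters s ++ P, ?_, ?_, ?_⟩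
  · rw [List.append_assoc (V ++ _)]
    refine hV.append_overlap (isReduced_of_forall_snd_eq (e := true) ?_) (tailLetters_ne_nil s)
    simp only [List.mem_append]
    rintro x (hx | hx | hx)
    exacts [snd_of_mem_tailLetters x hx, hP x hx, snd_of_mem_tailLetters x hx]
  · simp [mul_mk]
  · simp [length_tailLetters]
    omega

theorem pos_neg (hP : ∀ x ∈ P, x.2 = true) (hs : s ≠ s') (h : EndsIn P s true g n) :
    EndsIn P s' false (g * (mk (P ++ tailLetters s'))⁻¹) (n + 2 - P.length) := by
  obtain ⟨V, hV, rfl, hn⟩ := h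
  refine ⟨V ++ tailLetters s, ?_, ?_, ?_⟩
  · refine (hV.append_overlap ?_ (tailLetters_ne_nil s)).append_overlap
      (isReduced_of_forall_snd_eq (e := false) ?_)
      (by simpa [← List.length_eq_zero_iff] using tailLetters_ne_nil s')
    · cases s <;> cases s' <;> simp_all [tailLetters, invRev, FreeGroup.IsReduced]
    · rw [← invRev_append]
      refine snd_of_mem_invRev fun x hx => ?_
      rcases List.mem_append.mp hx with hx | hx
      exacts [hP x hx, snd_of_mem_tailLetters x hx]
  · simp [mul_mk, inv_mk, invRev_append]
  · simp [length_tailLetters]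
    omega

theorem neg_neg (hP : ∀ x ∈ P, x.2 = true) (h : EndsIn P s false g n) :
    EndsIn P s' false (g * (mk (P ++ tailLetters s'))⁻¹) (n + P.length + 2) := by
  obtain ⟨V, hV, rfl, hn⟩ := h
  refine ⟨V ++ invRev (tailLetters s) ++ invRev P, ?_, ?_, ?_⟩
  · rw [List.append_assoc V] at hV ⊢
    rw [List.append_assoc (V ++ _)]
    refine hV.append_overlap (isReduced_of_forall_snd_eq (e := false) ?_) ?_
    · rw [← invRev_append, ← invRev_append, ← invRev_append]
      refine snd_of_mem_invRev fun x hx => ?_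
      simp only [List.mem_append] at hx
      rcases hx with (hx | hx) | hx | hx
      exacts [hP x hx, snd_of_mem_tailLetters x hx, hP x hx, snd_of_mem_tailLetters x hx]
    · have := tailLetters_ne_nil s
      simp [← List.length_eq_zero_iff] at this ⊢
      simp [this]
  · simp [mul_mk, inv_mk, invRev_append]
  · simp [length_tailLetters]
    omega

theorem neg_pos (hs : s ≠ s') (h : EndsIn P s false g n) :
    EndsIn P s' true (g * mk (P ++ tailLetters s')) (n + P.length + 2) := by
  obtain ⟨V, hV, rfl, hn⟩ := h
  refine ⟨V ++ invRev (tailLetters s), ?_, ?_, ?_⟩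
  · refine (hV.infix ⟨[], invRev P, by simp⟩).append_overlap ?_
      (by simpa [← List.length_eq_zero_iff] using tailLetters_ne_nil s)
    cases s <;> cases s' <;> simp_all [tailLetters, invRev, FreeGroup.IsReduced]
  · simp only [← mul_mk, ← inv_mk]
    group
  · simp [length_tailLetters]
    omega

theorem mono {e : Bool} {m : ℤ} (h : EndsIn P s e g n) (hm : m ≤ n) : EndsIn P s e g m := by
  cases e <;> obtain ⟨V, hV, hg, hn⟩ := h <;> exact ⟨V, hV, hg, by omega⟩

theorem mul_pow (hP : ∀ x ∈ P, x.2 = true) (h : EndsIn P s true g n) (k : ℕ) :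
    EndsIn P s true (g * mk (P ++ tailLetters s) ^ k) (n + k) := by
  induction k with
  | zero => simpa using h
  | succ k ih =>
    rw [pow_succ, ← mul_assoc]
    exact (ih.pos_pos hP).mono (by push_cast; omega)

theorem mul_inv_pow (hP : ∀ x ∈ P, x.2 = true) (h : EndsIn P s false g n) (k : ℕ) :
    EndsIn P s false (g * ((mk (P ++ tailLetters s))⁻¹) ^ k) (n + k) := by
  induction k with
  | zero => simpa using h
  | succ k ih =>
    rw [pow_succ, ← mul_assoc]
    exact (ih.neg_neg hP).mono (by push_cast; omega)

theorem mul_zpow (hP : ∀ x ∈ P, x.2 = true) (hs : s ≠ s') {e : Bool} (h : EndsIn P s e g n)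
    {p : ℤ} (hp : p ≠ 0) :
    EndsIn P s' (decide (0 < p)) (g * mk (P ++ tailLetters s') ^ p)
      (n + p.natAbs + 1 + if e ∧ p < 0 then -(P.length : ℤ) else P.length) := by
  rcases lt_or_gt_of_ne hp with h0 | h0
  · obtain ⟨k, rfl⟩ : ∃ k : ℕ, p = -(k + 1) := ⟨(-p - 1).toNat, by omega⟩
    have h1 : mk (P ++ tailLetters s') ^ (-((k : ℤ) + 1)) =
        (mk (P ++ tailLetters s'))⁻¹ * (mk (P ++ tailLetters s'))⁻¹ ^ k := by
      rw [← pow_succ', inv_pow, zpow_neg]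
      norm_cast
    rw [decide_eq_false (by omega), h1, ← mul_assoc]
    cases e
    · rw [if_neg (by simp)]
      exact ((h.neg_neg hP).mul_inv_pow hP k).mono (by omega)
    · rw [if_pos ⟨rfl, h0⟩]
      exact ((h.pos_neg hP hs).mul_inv_pow hP k).mono (by omega)
  · obtain ⟨k, rfl⟩ : ∃ k : ℕ, p = k + 1 := ⟨(p - 1).toNat, by omega⟩
    have h1 : mk (P ++ tailLetters s') ^ ((k : ℤ) + 1) =
        mk (P ++ tailLetters s') * mk (P ++ tailLetters s') ^ k := by
      rw [← pow_succ']
      norm_cast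
    rw [decide_eq_true h0, h1, ← mul_assoc, if_neg (by omega)]
    cases e
    · exact ((h.neg_pos hs).mul_pow hP k).mono (by omega)
    · exact ((h.pos_pos hP).mul_pow hP k).mono (by omega)

theorem mul_prod (hP : ∀ x ∈ P, x.2 = true) {l : List (ℤ × ℤ)}
    (hl : ∀ p ∈ l, p.1 ≠ 0 ∧ p.2 ≠ 0) {e : Bool} (h : EndsIn P false e g n) :
    ∃ e', EndsIn P false e' (g * (l.map fun p => mk (P ++ tailLetters true) ^ p.1 *
      mk (P ++ tailLetters false) ^ p.2).prod) (n + blocksLength l) := by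
  induction l generalizing g n e with
  | nil => exact ⟨e, by simpa [blocksLength] using h⟩
  | cons p l ih =>
    have hp := hl p List.mem_cons_self
    have h1 := (h.mul_zpow hP (s' := true) (by decide) hp.1).mul_zpow hP (s' := false)
      (by decide) hp.2
    obtain ⟨e', h2⟩ := ih (fun q hq => hl q (List.mem_cons_of_mem _ hq)) h1
    refine ⟨e', ?_⟩
    rw [List.map_cons, List.prod_cons, ← mul_assoc, ← mul_assoc]
    refine h2.mono ?_
    simp only [blocksLength, List.map_cons, List.sum_cons, decide_eq_true_eq]
    push_cast
    split_ifs <;> omega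

end EndsIn

theorem positiveAut_ab (w : List Bool) : ∃ P : List (Fin 2 × Bool), (∀ x ∈ P, x.2 = true) ∧
    positiveAut w (b * a) = mk (P ++ tailLetters true) ∧
    positiveAut w (a * b) = mk (P ++ tailLetters false) := by
  suffices h : ∃ U V P : List (Fin 2 × Bool), ((∀ x ∈ U, x.2 = true) ∧ (∀ x ∈ V, x.2 = true) ∧
      ∀ x ∈ P, x.2 = true) ∧ positiveAut w a = mk U ∧ positiveAut w b = mk V ∧
      positiveAut w (b * a) = mk P * (b * a) ∧ positiveAut w (a * b) = mk P * (a * b) by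
    obtain ⟨-, -, P, ⟨-, -, hP⟩, -, -, h1, h2⟩ := h
    exact ⟨P, hP, h1.trans (mul_mk (L₂ := tailLetters true)),
      h2.trans (mul_mk (L₂ := tailLetters false))⟩
  induction w using List.reverseRecOn with
  | nil => exact ⟨[(0, true)], [(1, true)], [], by simp, rfl, rfl, rfl, rfl⟩
  | append_singleton w e ih =>
    obtain ⟨U, V, P, ⟨hU, hV, hP⟩, h1, h2, h3, h4⟩ := ih
    have append {A B : List (Fin 2 × Bool)} (hA : ∀ x ∈ A, x.2 = true)
        (hB : ∀ x ∈ B, x.2 = true) : ∀ x ∈ A ++ B, x.2 = true := fun x hx =>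
      (List.mem_append.mp hx).elim (hA x) (hB x)
    cases e
    · refine ⟨V ++ U, V, V ++ P, ⟨append hV hU, hV, append hV hP⟩, ?_⟩
      simp only [positiveAut_concat, cond_false, map_mul, transR_a, transR_b] at h3 h4 ⊢
      refine ⟨by rw [h1, h2, mul_mk], h2, ?_, ?_⟩
      · rw [h3, ← mul_mk, h2, mul_assoc]
      · rw [mul_assoc, h4, ← mul_mk, h2, mul_assoc]
    · refine ⟨U, U ++ V, U ++ P, ⟨hU, append hU hV, append hU hP⟩, ?_⟩
      simp only [positiveAut_concat, cond_true, map_mul, transL_a, transL_b] at h3 h4 ⊢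
      refine ⟨h1, by rw [h1, h2, mul_mk], ?_, ?_⟩
      · rw [mul_assoc, h3, ← mul_mk, h1, mul_assoc]
      · rw [h4, ← mul_mk, h1, mul_assoc]

theorem exists_mk_eq_a_zpow {p : ℤ} (hp : p ≠ 0) : ∃ L : List (Fin 2 × Bool),
    (a ^ p : F) = mk L ∧ L.length = p.natAbs ∧ L ≠ [] ∧
    ∀ d e, IsReduced ((1, d) :: L ++ [(1, e)]) := by
  have key (k : ℕ) (c e : Bool) (x : Fin 2 × Bool) (hx : x.1 = 0 → x.2 = c) :
      FreeGroup.IsReduced (x :: List.replicate (k + 1) (0, c) ++ [(1, e)]) := by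
    induction k generalizing x with
    | zero => simpa [FreeGroup.IsReduced] using hx
    | succ k ih =>
      have h := ih (0, c) fun _ => rfl
      rw [List.replicate_succ]
      exact List.IsChain.cons_cons hx h
  have reduced (k : ℕ) (c : Bool) (hk : k ≠ 0) (d e : Bool) :
      FreeGroup.IsReduced (((1 : Fin 2), d) :: List.replicate k (0, c) ++ [(1, e)]) := by
    obtain ⟨k, rfl⟩ := Nat.exists_eq_succ_of_ne_zero hk
    exact key k c e (1, d) (by simp)
  have hpow (k : ℕ) : (a ^ k : F) = mk (List.replicate k (0, true)) := by
    rw [← mk_toWord (x := a ^ k), a, toWord_of_pow]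
  obtain ⟨k, rfl | rfl⟩ := p.eq_nat_or_neg
  · refine ⟨_, (zpow_natCast a k).trans (hpow k), by simp, by simpa using hp, ?_⟩
    exact reduced k true (by simpa using hp)
  · refine ⟨List.replicate k (0, false), ?_, by simp, by simpa using hp, ?_⟩
    · rw [zpow_neg, zpow_natCast, hpow, inv_mk]
      simp [invRev]
    · exact reduced k false (by simpa using hp)

theorem blocksLength_le_norm_b_mul_blocks {l : List (ℤ × ℤ)}
    (hl : ∀ p ∈ l, p.1 ≠ 0 ∧ p.2 ≠ 0) : blocksLength l ≤ norm (b * blocks l) := by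
  suffices h : ∀ V : List (Fin 2 × Bool), FreeGroup.IsReduced (V ++ [(1, true)]) →
      ∃ W, FreeGroup.IsReduced (W ++ [(1, true)]) ∧
      mk (V ++ [(1, true)]) * blocks l = mk (W ++ [(1, true)]) ∧
      V.length + blocksLength l ≤ W.length by
    obtain ⟨W, h1, h2, h3⟩ := h [] FreeGroup.IsReduced.singleton
    have : b * blocks l = mk (W ++ [(1, true)]) := h2
    rw [this, FreeGroup.norm, toWord_mk, h1.reduce_eq]
    simp at h3 ⊢
    omega
  induction l with
  | nil => exact fun V hV => ⟨V, hV, by simp [blocks], by simp [blocksLength]⟩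
  | cons p l ih =>
    intro V hV
    obtain ⟨⟨hp, hq⟩, hl⟩ := List.forall_mem_cons.mp hl
    obtain ⟨L, hL, hL1, hL2, hL3⟩ := exists_mk_eq_a_zpow hp
    obtain ⟨M, hM, hM1, hM2, hM3⟩ := exists_mk_eq_a_zpow hq
    obtain ⟨W, h1, h2, h3⟩ := ih hl (V ++ [(1, true)] ++ L ++ [(1, false)] ++ M) (by
      have h1 := hV.append_overlap (L₂ := [_]) (hL3 true false) (by simp)
      have h2 : FreeGroup.IsReduced (V ++ [(1, true)] ++ L ++ [(1, false)]) := by simpa using h1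
      have h3 := h2.append_overlap (L₂ := [_]) (hM3 false true) (by simp)
      simpa using h3)
    refine ⟨W, h1, ?_, ?_⟩
    · rw [← h2]
      simp only [← mul_mk, ← hL, ← hM, blocks, List.map_cons, List.prod_cons, mul_assoc]
      rfl
    · simp [blocksLength] at h3 ⊢
      omega

theorem exists_blocksLength_le_norm_positiveAut (w : List Bool) : ∃ K, ∀ l : List (ℤ × ℤ),
    (∀ p ∈ l, p.1 ≠ 0 ∧ p.2 ≠ 0) → blocksLength l ≤ norm (positiveAut w (blocks l)) + K := by
  induction w using List.reverseRecOn with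
  | nil =>
    refine ⟨1, fun l hl => (blocksLength_le_norm_b_mul_blocks hl).trans ?_⟩
    rw [add_comm, ← norm_b]
    exact FreeGroup.norm_mul_le _ _
  | append_singleton w e ih =>
    cases e
    · obtain ⟨P, hP, h1, h2⟩ := positiveAut_ab w
      refine ⟨norm (mk (P ++ tailLetters false)), fun l hl => ?_⟩
      have h0 : EndsIn P false true (mk (P ++ tailLetters false)) 0 :=
        ⟨P, isReduced_of_forall_snd_eq (e := true) fun x hx => (List.mem_append.mp hx).elim (hP x)
          (snd_of_mem_tailLetters x), rfl, by omega⟩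
      obtain ⟨e', h⟩ := h0.mul_prod hP hl
      have h3 : positiveAut (w ++ [false]) (blocks l) = (l.map fun p =>
          mk (P ++ tailLetters true) ^ p.1 * mk (P ++ tailLetters false) ^ p.2).prod := by
        rw [positiveAut_concat, cond_false, transR_blocks, map_list_prod, List.map_map]
        simp [Function.comp_def, ← h1, ← h2]
      have h4 := h.le_norm
      rw [← h3] at h4
      have h5 := FreeGroup.norm_mul_le (mk (P ++ tailLetters false))
        (positiveAut (w ++ [false]) (blocks l))
      omega
    · obtain ⟨K, hK⟩ := ih
      exact ⟨K, fun l hl => by simpa [positiveAut_concat, transL_blocks] using hK l hl⟩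

theorem blocks_flatten_replicate (l : List (ℤ × ℤ)) (k : ℕ) :
    blocks (List.replicate k l).flatten = blocks l ^ k := by
  simp [blocks, List.map_flatten, List.prod_flatten]

theorem blocksLength_flatten_replicate (l : List (ℤ × ℤ)) (k : ℕ) :
    blocksLength (List.replicate k l).flatten = k * blocksLength l := by
  simp [blocksLength, List.map_flatten, List.sum_flatten]

theorem norm_pow_le_mul (g : F) (k : ℕ) : norm (g ^ k) ≤ k * norm g := by
  induction k with
  | zero => simp
  | succ k ih =>
    rw [pow_succ, Nat.succ_mul]
    exact (FreeGroup.norm_mul_le _ _).trans (Nat.add_le_add_right ih _)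

theorem IsPositiveImage.le_norm {n : ℕ} {g : F} (h : IsPositiveImage n g) : n ≤ norm g := by
  obtain ⟨c, σ, hσ, w, l, hl, rfl, hg⟩ := h
  obtain ⟨K, hK⟩ := exists_blocksLength_le_norm_positiveAut w
  by_contra! hlt
  have key (k : ℕ) : k * blocksLength l ≤ k * norm g + (2 * norm c + K) := by
    have h1 := hK (List.replicate k l).flatten (by
      simp only [List.mem_flatten, List.mem_replicate]
      rintro p ⟨_, ⟨-, rfl⟩, hp⟩
      exact hl p hp)
    have h2 : σ (positiveAut w (blocks (List.replicate k l).flatten)) = c⁻¹ * g ^ k * c := by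
      rw [blocks_flatten_replicate, map_pow, map_pow, hg, conj_pow]
      group
    rw [← hσ, h2, blocksLength_flatten_replicate] at h1
    have h3 := FreeGroup.norm_mul_le (c⁻¹ * g ^ k) c
    have h4 := FreeGroup.norm_mul_le c⁻¹ (g ^ k)
    rw [norm_inv_eq] at h4
    have h5 := norm_pow_le_mul g k
    omega
  have h1 := key (2 * norm c + K + 1)
  nlinarith

theorem le_norm_pow {g : F} (hg : g ≠ 1) (k : ℕ) : k ≤ norm (g ^ k) := by
  obtain rfl | hk := eq_or_ne k 0
  · exact Nat.zero_le _
  have h : 1 ≤ (reduceCyclically g.toWord).length := by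
    rw [Nat.one_le_iff_ne_zero, Ne, List.length_eq_zero_iff]
    intro h
    have h1 := reduceCyclically.conj_conjugator_reduceCyclically g.toWord
    rw [h, List.append_nil] at h1
    apply hg
    rw [← mk_toWord (x := g), ← h1, ← mul_mk, ← inv_mk, mul_inv_cancel]
  rw [FreeGroup.norm, toWord_pow,
    reduceCyclically.reduce_flatten_replicate isReduced_toWord, if_neg hk]
  simp only [List.length_append, List.length_flatten, List.map_replicate, List.sum_replicate,
    smul_eq_mul]
  nlinarith

theorem norm_zpow_eq_norm_pow_natAbs (g : F) (p : ℤ) : norm (g ^ p) = norm (g ^ p.natAbs) := by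
  obtain ⟨k, rfl | rfl⟩ := p.eq_nat_or_neg <;> simp

theorem norm_a_zpow_le (p : ℤ) : norm (a ^ p) ≤ p.natAbs := by
  rw [norm_zpow_eq_norm_pow_natAbs]
  exact (norm_pow_le_mul a _).trans_eq (by rw [norm_a, mul_one])

theorem norm_a_zpow_le_norm_map (α : MulAut F) (p : ℤ) : norm (a ^ p) ≤ norm (α (a ^ p)) := by
  refine (norm_a_zpow_le p).trans ?_
  rw [map_zpow, norm_zpow_eq_norm_pow_natAbs]
  exact le_norm_pow (by simp [a]) _

theorem blocks_cons (p : ℤ × ℤ) (l : List (ℤ × ℤ)) :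
    blocks (p :: l) = a ^ p.1 * b⁻¹ * a ^ p.2 * b * blocks l := by
  simp [blocks]

theorem blocks_append (l m : List (ℤ × ℤ)) : blocks (l ++ m) = blocks l * blocks m := by
  simp [blocks]

theorem norm_blocks_le (l : List (ℤ × ℤ)) : norm (blocks l) ≤ blocksLength l := by
  induction l with
  | nil => simp [blocks]
  | cons p l ih =>
    have h1 := FreeGroup.norm_mul_le (a ^ p.1 * b⁻¹ * a ^ p.2 * b) (blocks l)
    have h2 := FreeGroup.norm_mul_le (a ^ p.1 * b⁻¹ * a ^ p.2) b
    have h3 := FreeGroup.norm_mul_le (a ^ p.1 * b⁻¹) (a ^ p.2)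
    have h4 := FreeGroup.norm_mul_le (a ^ p.1) b⁻¹
    have h5 := norm_a_zpow_le p.1
    have h6 := norm_a_zpow_le p.2
    rw [norm_inv_eq] at h4
    rw [norm_b] at h2 h4
    rw [blocks_cons]
    simp only [blocksLength, List.map_cons, List.sum_cons] at ih ⊢
    omega

theorem inv_b_mul_zpow_mul_b (q : ℤ) : b⁻¹ * a ^ q * b = (b⁻¹ * a * b) ^ q := by
  simpa using (conj_zpow (i := q) (a := b⁻¹) (b := a)).symm

theorem a_zpow_mem_H (p : ℤ) : a ^ p ∈ H :=
  zpow_mem (Subgroup.subset_closure (by simp)) p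

theorem blocks_mem_H (l : List (ℤ × ℤ)) : blocks l ∈ H := by
  refine Subgroup.list_prod_mem _ fun x hx => ?_
  obtain ⟨p, -, rfl⟩ := List.mem_map.mp hx
  rw [mul_assoc, mul_assoc, ← mul_assoc b⁻¹, inv_b_mul_zpow_mul_b]
  exact mul_mem (a_zpow_mem_H _) (zpow_mem (Subgroup.subset_closure (by simp)) _)

theorem exists_blocks_of_mem_H {g : F} (hg : g ∈ H) : ∃ l, g = blocks l := by
  induction hg using Subgroup.closure_induction with
  | mem x hx =>
    rcases hx with rfl | rfl
    · exact ⟨[(1, 0)], by simp [blocks]⟩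
    · exact ⟨[(0, 1)], by simp [blocks]⟩
  | one => exact ⟨[], rfl⟩
  | mul x y _ _ hx hy =>
    obtain ⟨l, rfl⟩ := hx
    obtain ⟨m, rfl⟩ := hy
    exact ⟨l ++ m, (blocks_append l m).symm⟩
  | inv x _ hx =>
    obtain ⟨l, rfl⟩ := hx
    clear * -
    induction l with
    | nil => exact ⟨[], by simp [blocks]⟩
    | cons p l ih =>
      obtain ⟨m, hm⟩ := ih
      refine ⟨m ++ [(0, -p.2), (-p.1, 0)], ?_⟩
      rw [blocks_append, ← hm, blocks_cons]
      simp [blocks, mul_assoc]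

theorem isConj_mul_comm {G : Type*} [Group G] (x y : G) : IsConj (x * y) (y * x) :=
  isConj_iff.mpr ⟨y, by group⟩

/-- Elements conjugate to a power of `a`, or to `blocks l` with all exponents in `l` nonzero. -/
def HasNormalForm (g : F) : Prop :=
  (∃ p : ℤ, IsConj g (a ^ p)) ∨ ∃ l, (∀ p ∈ l, p.1 ≠ 0 ∧ p.2 ≠ 0) ∧ IsConj g (blocks l)

theorem HasNormalForm.of_isConj {g h : F} (hh : HasNormalForm h) (hgh : IsConj g h) :
    HasNormalForm g := by
  rcases hh with ⟨p, hp⟩ | ⟨l, hl, hp⟩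
  exacts [.inl ⟨p, hgh.trans hp⟩, .inr ⟨l, hl, hgh.trans hp⟩]

theorem hasNormalForm_blocks (l : List (ℤ × ℤ)) : HasNormalForm (blocks l) := by
  induction hn : l.length using Nat.strong_induction_on generalizing l with
  | _ n ih =>
  subst hn
  by_cases hl : ∀ p ∈ l, p.1 ≠ 0 ∧ p.2 ≠ 0
  · exact .inr ⟨l, hl, IsConj.refl _⟩
  push Not at hl
  obtain ⟨⟨p, q⟩, hx, hpq⟩ := hl
  obtain ⟨s, t, rfl⟩ := List.append_of_mem hx
  have rot : IsConj (blocks (s ++ (p, q) :: t)) (blocks ((p, q) :: (t ++ s))) := by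
    rw [← List.cons_append, blocks_append, blocks_append]
    exact isConj_mul_comm _ _
  refine HasNormalForm.of_isConj ?_ rot
  have hlen : (t ++ s).length < (s ++ (p, q) :: t).length := by simp; omega
  generalize t ++ s = r at hlen
  by_cases hp : p = 0
  · subst hp
    rcases List.eq_nil_or_concat r with rfl | ⟨r, ⟨p', q'⟩, rfl⟩
    · refine .inl ⟨q, ?_⟩
      rw [blocks_cons]
      exact isConj_iff.mpr ⟨b, by simp [blocks]; group⟩
    · refine (ih _ (by simpa using hlen) (r ++ [(p', q' + q)]) rfl).of_isConj ?_
      rw [blocks_cons]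
      convert isConj_mul_comm _ _ using 1
      simp [blocks, zpow_add, mul_assoc]
  · obtain rfl : q = 0 := hpq hp
    match r with
    | [] => exact .inl ⟨p, by simpa [blocks] using IsConj.refl (a ^ p)⟩
    | (p', q') :: r =>
      convert ih _ (by simpa using hlen) ((p + p', q') :: r) rfl using 1
      simp [blocks, zpow_add, mul_assoc]

/-- Some automorphic image of `S` lies in `⟨a, b⁻¹ab⟩` if and only if some element of
the `Aut F(a,b)`-orbit of `S` of shortest length in that orbit lies in `⟨a, b⁻¹ab⟩`. -/
theorem exists_aut_image_iff_exists_shortest (S : F) :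
    (∃ ψ : F ≃* F, ψ S ∈ H) ↔
    (∃ T : F, (∃ α : F ≃* F, α S = T) ∧
      (∀ α : F ≃* F, FreeGroup.norm T ≤ FreeGroup.norm (α S)) ∧ T ∈ H) := by
  constructor
  · rintro ⟨ψ, hψ⟩
    suffices h : ∃ T ∈ H, IsConj (ψ S) T ∧ ∀ α : MulAut F, norm T ≤ norm (α T) by
      obtain ⟨T, hT, hc, hmin⟩ := h
      obtain ⟨c, hc⟩ := isConj_iff.mp hc
      have hST : (ψ.trans (MulAut.conj c)) S = T := hc
      refine ⟨T, ⟨_, hST⟩, fun α => ?_, hT⟩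
      convert hmin ((ψ.trans (MulAut.conj c)).symm.trans α) using 2
      rw [MulEquiv.trans_apply, ← hST, MulEquiv.symm_apply_apply]
    obtain ⟨l, hl⟩ := exists_blocks_of_mem_H hψ
    rw [hl]
    rcases hasNormalForm_blocks l with ⟨p, hp⟩ | ⟨m, hm, hp⟩
    · exact ⟨_, a_zpow_mem_H p, hp, fun α => norm_a_zpow_le_norm_map α p⟩
    · refine ⟨_, blocks_mem_H m, hp, fun α => (norm_blocks_le m).trans ?_⟩
      have h : IsPositiveImage (blocksLength m) (blocks m) :=
        ⟨1, 1, one_mem _, [], m, hm, rfl, by simp [positiveAut]⟩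
      exact (h.map α).le_norm
  · rintro ⟨_, ⟨α, rfl⟩, -, hT⟩
    exact ⟨α, hT⟩
end
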